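/- Let a ≤ −2 be a real number and let P ∈ E_a(ℝ) be a point of infinite order not lying in the identity component E_a⁰(ℝ) (so −√(−a) < x(P) < 0). Then −(1/4)·log|a| − 1/(2·√|a|) < ( (1/2)·log max{1, |x(P)|} − (1/12)·log|Δ(E_a)| ) − λ_∞(P) < −(1/4)·log 2. -/

import Mathlib

open Filter Real

/-- The elliptic curve `y² = x³ + a·x` over a field. -/
def Ecurve {F : Type*} [Field F] (a : F) : WeierstrassCurve.Affine F :=
  { a₁ := 0, a₂ := 0, a₃ := 0, a₄ := a, a₆ := 0 }

/-- The x-coordinate of a point (with junk value `0` at the identity `O`). -/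
def xc {F : Type*} [Field F] {W : WeierstrassCurve.Affine F} : W.Point → F
  | .zero => 0
  | @WeierstrassCurve.Affine.Point.some _ _ _ x _ _ => x

/-- For `E_a : y² = x³ + ax`, the quantity `z(Q) = (1 − a/x(Q)²)²` from Tate's series. -/
noncomputable def zE (a : ℝ) (x : ℝ) : ℝ := (1 - a / x ^ 2) ^ 2

/-- The archimedean local height
`λ_∞(P) = (1/2)log|x(P)| + (1/8)·S − (1/12)·log|Δ(E_a)|` of a point of infinite order,
where `S` is the (hypothesized) sum of Tate's series `∑_{k≥0} 4^{−k}·log z(2^kP)`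
and `Δ(E_a) = −64a³`. -/
noncomputable def lamInf (a : ℝ) {W : WeierstrassCurve.Affine ℝ} (P : W.Point) (S : ℝ) : ℝ :=
  (1 / 2) * Real.log |xc P| + (1 / 8) * S - (1 / 12) * Real.log |(-64) * a ^ 3|

lemma xc_two_nsmul {a : ℝ} (Q : (Ecurve a).Point) (h : xc ((2 : ℕ) • Q) ≠ 0) :
    0 < xc Q * (xc Q ^ 2 + a) ∧
      xc ((2 : ℕ) • Q) = (xc Q ^ 2 - a) ^ 2 / (4 * (xc Q * (xc Q ^ 2 + a))) := by
  rw [two_nsmul] at h ⊢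
  rcases Q with _ | ⟨x, y, hQ⟩
  · exact absurd rfl h
  · have heq := (WeierstrassCurve.Affine.equation_iff _ _).1 hQ.1
    by_cases hy : y = (Ecurve a).negY x y
    · rw [WeierstrassCurve.Affine.Point.add_self_of_Y_eq hy] at h
      exact absurd rfl h
    · rw [WeierstrassCurve.Affine.Point.add_self_of_Y_ne hy]
      simp only [xc, WeierstrassCurve.Affine.addX, WeierstrassCurve.Affine.slope_of_Y_ne rfl hy]
      simp only [WeierstrassCurve.Affine.negY, Ecurve] at hy heq ⊢
      have hy0 : y ≠ 0 := by
        rintro rfl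
        simp at hy
      have hr : x * (x ^ 2 + a) = y ^ 2 := by linarith
      rw [hr]
      refine ⟨by positivity, ?_⟩
      have h2 : y - (-y - 0 * x - 0) = 2 * y := by ring
      rw [h2]
      field_simp
      linear_combination -32 * x * heq

lemma duplication_potential_le {u : ℝ} (h0 : 0 ≤ u) (h1 : u ≤ 1) {w : ℝ}
    (hw : w = 4 * u * (1 - u ^ 2) / (1 + u ^ 2) ^ 2) :
    log (1 + u ^ 2) + (1 / 4) * (2 * w - w ^ 2) ≤ 2 * u - u ^ 2 := by
  have hl : log (1 + u ^ 2) ≤ u ^ 2 := by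
    have := log_le_sub_one_of_pos (x := 1 + u ^ 2) (by positivity)
    linarith
  have hp : 0 ≤ u ^ 7 + 4 * u ^ 5 - u ^ 4 + 3 * u ^ 3 - 4 * u ^ 2 + 4 * u + 1 := by
    have e1 : u ^ 4 ≤ u ^ 3 := pow_le_pow_of_le_one h0 h1 (by norm_num)
    have e2 : u ^ 2 ≤ u := pow_le_of_le_one h0 h1 (by norm_num)
    have e3 : 0 ≤ u ^ 7 := by positivity
    have e4 : 0 ≤ u ^ 5 := by positivity
    have e5 : 0 ≤ u ^ 3 := by positivity
    linarith
  have key : 2 * u - u ^ 2 - u ^ 2 - (1 / 4) * (2 * w - w ^ 2) =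
      2 * u ^ 2 * (1 - u) *
        (u ^ 7 + 4 * u ^ 5 - u ^ 4 + 3 * u ^ 3 - 4 * u ^ 2 + 4 * u + 1) / (1 + u ^ 2) ^ 4 := by
    rw [hw]
    field_simp
    ring
  have : 0 ≤ 2 * u ^ 2 * (1 - u) *
        (u ^ 7 + 4 * u ^ 5 - u ^ 4 + 3 * u ^ 3 - 4 * u ^ 2 + 4 * u + 1) / (1 + u ^ 2) ^ 4 := by
    have := sub_nonneg.2 h1
    positivity
  linarith

lemma sum_log_one_add_sq_le {u : ℕ → ℝ} (h0 : ∀ k, 0 ≤ u k) (h1 : ∀ k, u k ≤ 1)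
    (hu : ∀ k, u (k + 1) = 4 * u k * (1 - u k ^ 2) / (1 + u k ^ 2) ^ 2) (n : ℕ) :
    ∑ k ∈ Finset.range n, (1 / 4 : ℝ) ^ k * log (1 + u k ^ 2) ≤ 2 * u 0 - u 0 ^ 2 := by
  have h : ∑ k ∈ Finset.range n, (1 / 4 : ℝ) ^ k * log (1 + u k ^ 2) ≤
      (2 * u 0 - u 0 ^ 2) - (1 / 4 : ℝ) ^ n * (2 * u n - u n ^ 2) := by
    induction n with
    | zero => simp
    | succ n ih =>
      have := mul_le_mul_of_nonneg_left (duplication_potential_le (h0 n) (h1 n) (hu n))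
        (by positivity : (0 : ℝ) ≤ (1 / 4) ^ n)
      rw [Finset.sum_range_succ, pow_succ (1 / 4 : ℝ) n]
      linarith
  have : 0 ≤ (1 / 4 : ℝ) ^ n * (2 * u n - u n ^ 2) := by
    have : 0 ≤ 2 * u n - u n ^ 2 := by nlinarith [h0 n, h1 n]
    positivity
  linarith

lemma tate_series_le {b S : ℝ} {x : ℕ → ℝ} (hb : 0 < b) (hx0 : x 0 < 0)
    (hpos : ∀ k, 0 < x k * (x k ^ 2 - b))
    (hx : ∀ k, x (k + 1) = (x k ^ 2 + b) ^ 2 / (4 * (x k * (x k ^ 2 - b))))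
    (hS : HasSum (fun k : ℕ => (1 / 4 : ℝ) ^ k * log ((1 + b / x k ^ 2) ^ 2)) S) :
    S ≤ 2 * (log b - 2 * log |x 0| + 2 * (|x 0| / √b) - (|x 0| / √b) ^ 2) := by
  have hs : 0 < √b := sqrt_pos.2 hb
  have hsb : √b ^ 2 = b := sq_sqrt hb.le
  have hxp : ∀ k, 0 < x (k + 1) := fun k => by
    have := hpos k
    have := hpos (k + 1)
    rw [hx k]
    positivity
  have hlt : x 0 ^ 2 < b := by nlinarith [hpos 0]
  set u : ℕ → ℝ := fun k => if k = 0 then |x 0| / √b else √b / x k with hu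
  have u0 : u 0 = |x 0| / √b := by simp [hu]
  have us : ∀ k, u (k + 1) = √b / x (k + 1) := fun k => by simp [hu]
  have h0 : ∀ k, 0 ≤ u k := by
    rintro (_ | k)
    · rw [u0]; positivity
    · rw [us]; have := hxp k; positivity
  have h1 : ∀ k, u k ≤ 1 := by
    rintro (_ | k)
    · rw [u0, div_le_one hs]
      exact abs_le_sqrt hlt.le
    · rw [us, div_le_one (hxp k), sqrt_le_left (hxp k).le]
      nlinarith [hpos (k + 1), hxp k]
  have hrec : ∀ k, u (k + 1) = 4 * u k * (1 - u k ^ 2) / (1 + u k ^ 2) ^ 2 := by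
    rintro (_ | k)
    · have h2 := right_ne_zero_of_mul (hpos 0).ne'
      rw [us, u0, hx, abs_of_neg hx0]
      clear_value u
      generalize √b = s at hs hsb ⊢
      subst hsb
      have := hx0.ne
      field_simp
      ring
    · have h2 := right_ne_zero_of_mul (hpos (k + 1)).ne'
      have h3 := (hxp k).ne'
      rw [us, us, hx]
      clear_value u
      generalize √b = s at hs hsb ⊢
      subst hsb
      field_simp
  have hterm : ∀ n, ∑ k ∈ Finset.range (n + 1), (1 / 4 : ℝ) ^ k * log ((1 + b / x k ^ 2) ^ 2) =
      2 * (log b - 2 * log |x 0|) +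
        2 * ∑ k ∈ Finset.range (n + 1), (1 / 4 : ℝ) ^ k * log (1 + u k ^ 2) := by
    intro n
    rw [Finset.sum_range_succ', Finset.sum_range_succ', mul_add, Finset.mul_sum]
    have e1 : ∀ k, (1 / 4 : ℝ) ^ (k + 1) * log ((1 + b / x (k + 1) ^ 2) ^ 2) =
        2 * ((1 / 4 : ℝ) ^ (k + 1) * log (1 + u (k + 1) ^ 2)) := fun k => by
      rw [us, div_pow (√b), hsb, log_pow]
      push_cast
      ring
    have e2 : log (1 + b / x 0 ^ 2) = log b - 2 * log |x 0| + log (1 + u 0 ^ 2) := by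
      have hx0 := hx0.ne
      have hx2 : 0 < x 0 ^ 2 := by positivity
      have h2 : 2 * log |x 0| = log (x 0 ^ 2) := by rw [log_pow, log_abs]; norm_num
      rw [h2, u0, div_pow, hsb, sq_abs, ← log_div hb.ne' hx2.ne', ← log_mul (by positivity)
        (by positivity)]
      congr 1
      field_simp
      ring
    simp only [e1]
    simp only [log_pow, e2, pow_zero]
    push_cast
    ring
  have ht := (tendsto_add_atTop_iff_nat 1).2 hS.tendsto_sum_nat
  refine le_of_tendsto' ht fun n => ?_
  have := sum_log_one_add_sq_le h0 h1 hrec (n + 1)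
  rw [hterm, ← u0]
  linarith

/-- Lemma 3.1(c): for `a ≤ −2` and a point `P ∈ E_a(ℝ)` of infinite order outside the
identity component (so `−√(−a) < x(P) < 0`),
`−(1/4)·log|a| − 1/(2·√|a|)
  < ((1/2)·log max{1,|x(P)|} − (1/12)·log|Δ(E_a)|) − λ_∞(P) < −(1/4)·log 2`. -/
theorem arch_a_neg_part_c (a : ℝ) (ha : a ≤ -2)
    (P : (Ecurve a).Point)
    (hP : ∀ n : ℕ, 0 < n → n • P ≠ 0)
    (hx : ∀ k : ℕ, xc ((2 ^ k) • P) ≠ 0)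
    (hP1 : -Real.sqrt (-a) < xc P) (hP2 : xc P < 0)
    (S : ℝ)
    (hS : HasSum (fun k : ℕ => (1 / 4 : ℝ) ^ k * Real.log (zE a (xc ((2 ^ k) • P)))) S) :
    -(1 / 4) * Real.log |a| - 1 / (2 * Real.sqrt |a|)
        < ((1 / 2) * Real.log (max 1 |xc P|) - (1 / 12) * Real.log |(-64) * a ^ 3|)
            - lamInf a P S ∧
      ((1 / 2) * Real.log (max 1 |xc P|) - (1 / 12) * Real.log |(-64) * a ^ 3|)
          - lamInf a P S < -(1 / 4) * Real.log 2 := by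

  obtain ⟨b, rfl⟩ : ∃ b, a = -b := ⟨-a, by ring⟩
  have hb2 : 2 ≤ b := by linarith
  have hb : 0 < b := by linarith
  have hs : 0 < √b := sqrt_pos.2 hb
  have hsb : √b ^ 2 = b := sq_sqrt hb.le
  rw [neg_neg] at hP1
  have hdup := fun k : ℕ => xc_two_nsmul ((2 ^ k) • P)
    (by rw [← mul_nsmul', ← pow_succ']; exact hx (k + 1))
  have hrec : ∀ k : ℕ, xc ((2 ^ (k + 1)) • P) = (xc ((2 ^ k) • P) ^ 2 + b) ^ 2 /
      (4 * (xc ((2 ^ k) • P) * (xc ((2 ^ k) • P) ^ 2 - b))) := fun k => by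
    rw [pow_succ', mul_nsmul', (hdup k).2]
    ring
  simp only [zE, neg_div, sub_neg_eq_add] at hS
  have hle := tate_series_le (x := fun k => xc ((2 ^ k) • P)) hb (by simpa using hP2)
    (fun k => by simpa [sub_eq_add_neg] using (hdup k).1) hrec hS
  have hge := le_hasSum hS 0 fun k _ => by
    have : 0 ≤ b / xc ((2 ^ k) • P) ^ 2 := by positivity
    exact mul_nonneg (by positivity) (log_nonneg (one_le_pow₀ (by linarith)))
  simp only [pow_zero, one_nsmul, one_mul, log_pow] at hle hge
  push_cast at hge
  have hxa : |xc P| = -xc P := abs_of_neg hP2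
  have hsq : xc P ^ 2 = |xc P| ^ 2 := (sq_abs _).symm
  rw [hsq] at hge
  simp only [lamInf, abs_neg, abs_of_pos hb]
  generalize |xc P| = t at *
  have ht : 0 < t := by linarith
  have hts : t < √b := by linarith
  constructor
  · have hm : t / √b ≤ 1 / √b + log (max 1 t) := by
      rcases le_total t 1 with h | h
      · rw [max_eq_left h, log_one, add_zero]
        gcongr
      · rw [max_eq_right h]
        have h1 := one_sub_inv_le_log_of_pos ht
        have h2 : (t - 1) / √b ≤ (t - 1) / t :=
          div_le_div_of_nonneg_left (by linarith) ht hts.le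
        have h3 : (t - 1) / t = 1 - t⁻¹ := by field_simp
        rw [sub_div] at h2
        linarith
    have hv : 0 < (t / √b) ^ 2 := by positivity
    have : 1 / (2 * √b) = 1 / 2 * (1 / √b) := by ring
    rw [this]
    linarith
  · have hlog : log (1 + b / t ^ 2) = log (t ^ 2 + b) - 2 * log t := by
      have : 1 + b / t ^ 2 = (t ^ 2 + b) / t ^ 2 := by field_simp
      rw [this, log_div (by positivity) (by positivity), log_pow]
      norm_num
    have hm : log 2 + 2 * log (max 1 t) < log (t ^ 2 + b) := by
      have : log 2 + 2 * log (max 1 t) = log (2 * max 1 t ^ 2) := by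
        rw [log_mul (by norm_num) (by positivity), log_pow]
        norm_num
      rw [this]
      refine log_lt_log (by positivity) ?_
      rcases le_total t 1 with h | h
      · rw [max_eq_left h]
        nlinarith
      · rw [max_eq_right h]
        nlinarith
    linarith
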